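/- With a = (1+π)^{2/3}·(ln 2)², the least-squares error of the approximation erf(x)² ≈ 1 − exp(−a·x²) satisfies ∫₀^∞ (erf(x)² − (1 − exp(−a·x²)))² dx < 0.000026. -/

import Mathlib

open Real MeasureTheory

/-- The error function `erf x = (2/√π) ∫₀ˣ exp(−t²) dt`. -/
noncomputable def erf (x : ℝ) : ℝ := (2 / Real.sqrt π) * ∫ t in (0:ℝ)..x, Real.exp (-t ^ 2)

open Filter Topology Set

theorem erf_zero : erf 0 = 0 := by simp [erf]

theorem hasDerivAt_erf (x : ℝ) : HasDerivAt erf (2 / √π * exp (-x ^ 2)) x := by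
  have hc : Continuous fun t : ℝ => exp (-t ^ 2) := by fun_prop
  exact (intervalIntegral.integral_hasDerivAt_right (hc.intervalIntegrable _ _)
    hc.aestronglyMeasurable.stronglyMeasurableAtFilter hc.continuousAt).const_mul _

theorem continuous_erf : Continuous erf :=
  continuous_iff_continuousAt.2 fun x => (hasDerivAt_erf x).continuousAt

theorem erf_nonneg {x : ℝ} (hx : 0 ≤ x) : 0 ≤ erf x :=
  mul_nonneg (by positivity)
    (intervalIntegral.integral_nonneg hx fun _ _ => (exp_pos _).le)

theorem hasDerivAt_integral_exp_neg_sq_mul (x : ℝ) :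
    HasDerivAt (fun x : ℝ => ∫ t in (0 : ℝ)..1, exp (-x ^ 2 * (1 + t ^ 2)) / (1 + t ^ 2))
      (∫ t in (0 : ℝ)..1, -2 * x * exp (-x ^ 2 * (1 + t ^ 2))) x := by
  have hpos : ∀ t : ℝ, 1 + t ^ 2 ≠ 0 := fun t => by positivity
  refine (intervalIntegral.hasDerivAt_integral_of_dominated_loc_of_deriv_le
    (F := fun x t : ℝ => exp (-x ^ 2 * (1 + t ^ 2)) / (1 + t ^ 2))
    (F' := fun x t : ℝ => -2 * x * exp (-x ^ 2 * (1 + t ^ 2)))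
    (s := Metric.ball x 1) (bound := fun _ => 2 * (|x| + 1)) (Metric.ball_mem_nhds x one_pos)
    (Eventually.of_forall fun y =>
      Continuous.aestronglyMeasurable (by fun_prop (disch := simp [hpos])))
    (Continuous.intervalIntegrable (by fun_prop (disch := simp [hpos])) _ _)
    (Continuous.aestronglyMeasurable (by fun_prop))
    (Eventually.of_forall fun t _ y hy => ?_) intervalIntegrable_const
    (Eventually.of_forall fun t _ y _ => ?_)).2
  · have hy' : |y| ≤ |x| + 1 := by
      have h1 : |y - x| < 1 := by simpa [Real.dist_eq] using hy
      have h2 := abs_sub_abs_le_abs_sub y x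
      linarith
    have he : exp (-y ^ 2 * (1 + t ^ 2)) ≤ 1 := by
      rw [exp_le_one_iff]
      have : 0 ≤ y ^ 2 * (1 + t ^ 2) := by positivity
      linarith
    rw [norm_eq_abs, abs_mul, abs_mul, abs_exp, abs_neg, abs_two]
    calc 2 * |y| * exp (-y ^ 2 * (1 + t ^ 2)) ≤ 2 * |y| * 1 := by gcongr
      _ ≤ 2 * (|x| + 1) := by linarith
  · have h1 : HasDerivAt (fun y : ℝ => -y ^ 2 * (1 + t ^ 2)) (-(2 * y) * (1 + t ^ 2)) y := by
      simpa using ((hasDerivAt_pow 2 y).neg.mul_const (1 + t ^ 2))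
    refine (h1.exp.div_const (1 + t ^ 2)).congr_deriv ?_
    field_simp [hpos t]

/-- Craig's formula: the square of the error function as an integral over a fixed interval. -/
theorem one_sub_erf_sq (x : ℝ) :
    1 - erf x ^ 2 =
      4 / π * ∫ t in (0 : ℝ)..1, exp (-x ^ 2 * (1 + t ^ 2)) / (1 + t ^ 2) := by
  set G : ℝ → ℝ := fun x =>
    erf x ^ 2 + 4 / π * ∫ t in (0 : ℝ)..1, exp (-x ^ 2 * (1 + t ^ 2)) / (1 + t ^ 2) with hG
  have hderiv : ∀ y, HasDerivAt G 0 y := fun y => by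
    refine (((hasDerivAt_erf y).pow 2).add
      ((hasDerivAt_integral_exp_neg_sq_mul y).const_mul (4 / π))).congr_deriv ?_
    have hsub : y * ∫ t in (0 : ℝ)..1, exp (-(y * t) ^ 2) = ∫ t in (0 : ℝ)..y, exp (-t ^ 2) := by
      simpa using intervalIntegral.mul_integral_comp_mul_left (a := 0) (b := 1)
        (f := fun t => exp (-t ^ 2)) (c := y)
    have hsplit : ∫ t in (0 : ℝ)..1, -2 * y * exp (-y ^ 2 * (1 + t ^ 2)) =
        -2 * exp (-y ^ 2) * ∫ t in (0 : ℝ)..y, exp (-t ^ 2) := by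
      rw [← hsub, ← mul_assoc, ← intervalIntegral.integral_const_mul]
      refine intervalIntegral.integral_congr fun t _ => ?_
      rw [show -y ^ 2 * (1 + t ^ 2) = -y ^ 2 + -(y * t) ^ 2 by ring, exp_add]
      ring
    rw [hsplit, erf]
    have hs : √π ≠ 0 := by positivity
    have hp : π = √π ^ 2 := (sq_sqrt pi_pos.le).symm
    rw [show (4 : ℝ) / π = 4 / √π ^ 2 by rw [← hp]]
    simp only [Nat.cast_ofNat, Nat.add_one_sub_one, pow_one]
    field_simp
    norm_num
  have hconst : G x = G 0 :=
    is_const_of_deriv_eq_zero (fun y => (hderiv y).differentiableAt) (fun y => (hderiv y).deriv) x 0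
  have h0 : G 0 = 1 := by
    simp only [hG, erf_zero]
    simp
  rw [h0] at hconst
  simp only [hG] at hconst
  linarith

theorem erf_sq_le_one (x : ℝ) : erf x ^ 2 ≤ 1 := by
  have h : 0 ≤ 1 - erf x ^ 2 := by
    rw [one_sub_erf_sq]
    exact mul_nonneg (by positivity)
      (intervalIntegral.integral_nonneg zero_le_one fun t _ => by positivity)
  linarith

theorem one_sub_erf_sq_le (x : ℝ) : 1 - erf x ^ 2 ≤ exp (-x ^ 2) := by
  have hpos : ∀ t : ℝ, 1 + t ^ 2 ≠ 0 := fun t => by positivity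
  have h : ∫ t in (0 : ℝ)..1, exp (-x ^ 2 * (1 + t ^ 2)) / (1 + t ^ 2) ≤
      ∫ t in (0 : ℝ)..1, exp (-x ^ 2) * (1 / (1 + t ^ 2)) := by
    refine intervalIntegral.integral_mono_on zero_le_one
      (Continuous.intervalIntegrable (by fun_prop (disch := simp [hpos])) _ _)
      (Continuous.intervalIntegrable (by fun_prop (disch := simp [hpos])) _ _) fun t _ => ?_
    rw [mul_one_div]
    gcongr
    nlinarith [mul_nonneg (sq_nonneg x) (sq_nonneg t)]
  rw [intervalIntegral.integral_const_mul, integral_one_div_one_add_sq, arctan_one, arctan_zero,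
    sub_zero] at h
  rw [one_sub_erf_sq]
  calc _ ≤ 4 / π * (exp (-x ^ 2) * (π / 4)) := by gcongr
    _ = _ := by field_simp

theorem integral_inv_mul_inv_sqrt {a : ℝ} (ha : 0 < a) :
    ∫ t in (0 : ℝ)..1, 1 / ((1 + t ^ 2) * √(1 + a + t ^ 2)) =
      arctan (√(a / (2 + a))) / √a := by
  have hq : ∀ t : ℝ, 0 < 1 + a + t ^ 2 := fun t => by positivity
  have hsa : √a ≠ 0 := by positivity
  have hd : ∀ t : ℝ, HasDerivAt (fun t : ℝ => arctan (√a * t / √(1 + a + t ^ 2)) / √a)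
      (1 / ((1 + t ^ 2) * √(1 + a + t ^ 2))) t := fun t => by
    have hs : √(1 + a + t ^ 2) ≠ 0 := (sqrt_pos.2 (hq t)).ne'
    have h1 : HasDerivAt (fun t : ℝ => 1 + a + t ^ 2) (2 * t) t := by
      simpa using (hasDerivAt_pow 2 t).const_add (1 + a)
    have h2 := ((((hasDerivAt_id t).const_mul √a).div (h1.sqrt (hq t).ne') hs).arctan).div_const √a
    refine h2.congr_deriv ?_
    simp only [id, Pi.div_apply]
    have e1 : √(1 + a + t ^ 2) ^ 2 = 1 + a + t ^ 2 := sq_sqrt (hq t).le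
    have e2 : √a ^ 2 = a := sq_sqrt ha.le
    have e3 : 1 + (√a * t / √(1 + a + t ^ 2)) ^ 2 = (1 + a) * (1 + t ^ 2) / (1 + a + t ^ 2) := by
      rw [div_pow, mul_pow, e1, e2]
      field_simp [(hq t).ne']
      ring
    have e4 : √a * 1 * √(1 + a + t ^ 2) - √a * t * (2 * t / (2 * √(1 + a + t ^ 2))) =
        √a * (1 + a) / √(1 + a + t ^ 2) := by
      field_simp
      rw [e1]
      ring
    rw [e3, e4, e1]
    have := (hq t).ne'
    field_simp
  rw [intervalIntegral.integral_eq_sub_of_hasDerivAt (fun t _ => hd t)]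
  · rw [sqrt_div ha.le]
    norm_num [show (1 : ℝ) + a + 1 = 2 + a by ring]
  · refine Continuous.intervalIntegrable ?_ _ _
    have : ∀ t : ℝ, (1 + t ^ 2) * √(1 + a + t ^ 2) ≠ 0 := fun t => by
      have := sqrt_pos.2 (hq t)
      positivity
    fun_prop (disch := simpa using this)

theorem integral_exp_mul_one_sub_erf_sq {a : ℝ} (ha : 0 < a) :
    ∫ x in Ioi (0 : ℝ), exp (-a * x ^ 2) * (1 - erf x ^ 2) =
      2 / √(π * a) * arctan (√(a / (2 + a))) := by
  have hpos : ∀ t : ℝ, 1 + t ^ 2 ≠ 0 := fun t => by positivity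
  have hint : Integrable (Function.uncurry fun x t : ℝ =>
      exp (-a * x ^ 2) * (exp (-x ^ 2 * (1 + t ^ 2)) / (1 + t ^ 2)))
      ((volume.restrict (Ioi (0 : ℝ))).prod (volume.restrict (Ioc (0 : ℝ) 1))) := by
    refine Integrable.mono' (((integrable_exp_neg_mul_sq ha).restrict (s := Ioi 0)).mul_prod
      (integrable_const (1 : ℝ))) (Continuous.aestronglyMeasurable ?_)
      (Eventually.of_forall fun p => ?_)
    · simp only [Function.uncurry_def]
      fun_prop (disch := simp [hpos])
    · simp only [Function.uncurry_def, norm_eq_abs]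
      rw [abs_of_nonneg (by positivity)]
      gcongr
      rw [div_le_one (by positivity)]
      have h1 : exp (-p.1 ^ 2 * (1 + p.2 ^ 2)) ≤ 1 := by
        rw [exp_le_one_iff]
        have : 0 ≤ p.1 ^ 2 * (1 + p.2 ^ 2) := by positivity
        linarith
      nlinarith [sq_nonneg p.2]
  calc ∫ x in Ioi (0 : ℝ), exp (-a * x ^ 2) * (1 - erf x ^ 2)
      = 4 / π * ∫ x in Ioi (0 : ℝ), ∫ t in Ioc (0 : ℝ) 1,
          exp (-a * x ^ 2) * (exp (-x ^ 2 * (1 + t ^ 2)) / (1 + t ^ 2)) := by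
        rw [← integral_const_mul]
        congr 1 with x
        rw [one_sub_erf_sq, intervalIntegral.integral_of_le zero_le_one, integral_const_mul]
        ring
    _ = 4 / π * ∫ t in Ioc (0 : ℝ) 1, ∫ x in Ioi (0 : ℝ),
          exp (-a * x ^ 2) * (exp (-x ^ 2 * (1 + t ^ 2)) / (1 + t ^ 2)) := by
        rw [integral_integral_swap hint]
    _ = 4 / π * ∫ t in Ioc (0 : ℝ) 1, √π / 2 * (1 / ((1 + t ^ 2) * √(1 + a + t ^ 2))) := by
        congr 2 with t
        have : ∀ x : ℝ, exp (-a * x ^ 2) * (exp (-x ^ 2 * (1 + t ^ 2)) / (1 + t ^ 2)) =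
            1 / (1 + t ^ 2) * exp (-(1 + a + t ^ 2) * x ^ 2) := fun x => by
          rw [show -(1 + a + t ^ 2) * x ^ 2 = -a * x ^ 2 + -x ^ 2 * (1 + t ^ 2) by ring, exp_add]
          ring
        simp_rw [this]
        rw [integral_const_mul, integral_gaussian_Ioi, sqrt_div pi_pos.le]
        field_simp
    _ = _ := by
        rw [integral_const_mul, ← intervalIntegral.integral_of_le zero_le_one,
          integral_inv_mul_inv_sqrt ha, sqrt_mul pi_pos.le]
        have h1 : √π ≠ 0 := by positivity
        have h2 : √a ≠ 0 := by positivity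
        have hp : π = √π ^ 2 := (sq_sqrt pi_pos.le).symm
        rw [show (4 : ℝ) / π = 4 / √π ^ 2 by rw [← hp]]
        field_simp
        norm_num

theorem integrableOn_exp_mul_one_sub_erf_sq {a : ℝ} (ha : 0 < a) :
    IntegrableOn (fun x => exp (-a * x ^ 2) * (1 - erf x ^ 2)) (Ioi 0) := by
  have := continuous_erf
  refine Integrable.mono' ((integrable_exp_neg_mul_sq ha).restrict (s := Ioi 0))
    (Continuous.aestronglyMeasurable (by fun_prop)) (Eventually.of_forall fun x => ?_)
  rw [norm_eq_abs, abs_mul, abs_exp, abs_of_nonneg (by linarith [erf_sq_le_one x])]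
  exact mul_le_of_le_one_right (exp_pos _).le (by linarith [sq_nonneg (erf x)])

theorem integrableOn_one_sub_erf_sq_sq :
    IntegrableOn (fun x => (1 - erf x ^ 2) ^ 2) (Ioi 0) := by
  have := continuous_erf
  refine Integrable.mono' ((integrable_exp_neg_mul_sq one_pos).restrict (s := Ioi 0))
    (Continuous.aestronglyMeasurable (by fun_prop)) (Eventually.of_forall fun x => ?_)
  have h1 := erf_sq_le_one x
  have h2 := one_sub_erf_sq_le x
  rw [norm_eq_abs, abs_of_nonneg (sq_nonneg _), neg_one_mul]
  nlinarith [sq_nonneg (erf x)]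

theorem hasDerivAt_antideriv_one_sub_erf_sq_sq (x : ℝ) :
    HasDerivAt (fun x => x * (1 - erf x ^ 2) ^ 2 -
        2 * ((1 - erf x ^ 2) * erf x * (2 / √π * exp (-x ^ 2))))
      ((1 - erf x ^ 2) ^ 2 - 8 / π * (3 * (exp (-2 * x ^ 2) * (1 - erf x ^ 2)) -
        2 * exp (-2 * x ^ 2))) x := by
  have hE : HasDerivAt (fun x : ℝ => 2 / √π * exp (-x ^ 2))
      (2 / √π * (exp (-x ^ 2) * -(2 * x))) x := by
    simpa using (hasDerivAt_pow 2 x).neg.exp.const_mul (2 / √π)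
  have hg : HasDerivAt (fun x => 1 - erf x ^ 2)
      (-(2 * erf x * (2 / √π * exp (-x ^ 2)))) x := by
    simpa using ((hasDerivAt_erf x).pow 2).const_sub 1
  refine (((hasDerivAt_id x).mul (hg.pow 2)).sub
    (((hg.mul (hasDerivAt_erf x)).mul hE).const_mul 2)).congr_deriv ?_
  have he : exp (-2 * x ^ 2) = exp (-x ^ 2) ^ 2 := by rw [← exp_nat_mul]; congr 1; push_cast; ring
  have hp : 8 / π = 2 * (2 / √π) ^ 2 := by
    rw [div_pow, sq_sqrt pi_pos.le]; ring
  rw [he, hp]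
  simp
  ring

theorem tendsto_antideriv_one_sub_erf_sq_sq :
    Tendsto (fun x => x * (1 - erf x ^ 2) ^ 2 -
        2 * ((1 - erf x ^ 2) * erf x * (2 / √π * exp (-x ^ 2)))) atTop (𝓝 0) := by
  have hx : Tendsto (fun x : ℝ => x * exp (-x)) atTop (𝓝 0) := by
    simpa using tendsto_pow_mul_exp_neg_atTop_nhds_zero 1
  have he : Tendsto (fun x : ℝ => exp (-x)) atTop (𝓝 0) := tendsto_exp_neg_atTop_nhds_zero
  have hb := hx.add (he.const_mul (2 * (2 / √π)))
  simp only [mul_zero, add_zero] at hb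
  refine squeeze_zero_norm' ?_ hb
  filter_upwards [eventually_ge_atTop 1] with x hx1
  have h0 := erf_nonneg (zero_le_one.trans hx1)
  have h1 := erf_sq_le_one x
  have h1' : erf x ≤ 1 := by nlinarith
  have h3 : exp (-x ^ 2) ≤ exp (-x) := exp_le_exp.2 (by nlinarith)
  have h2 := (one_sub_erf_sq_le x).trans h3
  have hs : 0 ≤ 2 / √π := by positivity
  have hg : 0 ≤ 1 - erf x ^ 2 := by linarith
  have hg1 : 1 - erf x ^ 2 ≤ 1 := by nlinarith
  have hA : x * (1 - erf x ^ 2) ^ 2 ≤ x * exp (-x) := by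
    gcongr
    nlinarith
  have hA0 : 0 ≤ x * (1 - erf x ^ 2) ^ 2 := by positivity
  have hB : 2 * ((1 - erf x ^ 2) * erf x * (2 / √π * exp (-x ^ 2))) ≤
      2 * (1 * 1 * (2 / √π * exp (-x))) := by gcongr
  have hB0 : 0 ≤ 2 * ((1 - erf x ^ 2) * erf x * (2 / √π * exp (-x ^ 2))) := by positivity
  have hC : 0 ≤ x * exp (-x) := by positivity
  rw [norm_eq_abs, abs_le]
  constructor <;> linarith

theorem integral_one_sub_erf_sq_sq :
    ∫ x in Ioi (0 : ℝ), (1 - erf x ^ 2) ^ 2 =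
      8 / π * (3 * (2 / √(π * 2) * arctan (√(2 / (2 + 2)))) - 2 * (√(π / 2) / 2)) := by
  have i1 := integrableOn_one_sub_erf_sq_sq
  have i2 := (integrableOn_exp_mul_one_sub_erf_sq two_pos).const_mul 3
  have i3 := ((integrable_exp_neg_mul_sq two_pos).restrict (s := Ioi 0)).const_mul 2
  have i23 : Integrable (fun x => 3 * (exp (-2 * x ^ 2) * (1 - erf x ^ 2)) -
    2 * exp (-2 * x ^ 2)) (volume.restrict (Ioi 0)) := i2.sub i3
  have i4 := i23.const_mul (8 / π)
  have h := integral_Ioi_of_hasDerivAt_of_tendsto' (fun x _ => hasDerivAt_antideriv_one_sub_erf_sq_sq x)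
    (i1.sub i4) tendsto_antideriv_one_sub_erf_sq_sq
  rw [integral_sub i1 i4, integral_const_mul, integral_sub i2 i3, integral_const_mul,
    integral_const_mul, integral_exp_mul_one_sub_erf_sq two_pos, integral_gaussian_Ioi,
    erf_zero] at h
  simp only [mul_zero, zero_mul, sub_zero] at h
  linarith

/-- Closed form of the least-squares error for an arbitrary coefficient `a > 0`. -/
theorem lsqError_eq {a : ℝ} (ha : 0 < a) :
    ∫ x in Ioi (0 : ℝ), (erf x ^ 2 - (1 - exp (-a * x ^ 2))) ^ 2 =
      (π / (2 * √(2 * a)) - 4 / √a * arctan (√(a / (2 + a))) +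
        48 / (π * √2) * arctan (√(1 / 2)) - 8 / √2) / √π := by
  have i1 := integrableOn_one_sub_erf_sq_sq
  have i2 := (integrableOn_exp_mul_one_sub_erf_sq ha).const_mul 2
  have i3 := (integrable_exp_neg_mul_sq (b := 2 * a) (by positivity)).restrict (s := Ioi 0)
  have : ∀ x : ℝ, (erf x ^ 2 - (1 - exp (-a * x ^ 2))) ^ 2 =
      (1 - erf x ^ 2) ^ 2 - 2 * (exp (-a * x ^ 2) * (1 - erf x ^ 2)) +
        exp (-(2 * a) * x ^ 2) := fun x => by
    rw [show -(2 * a) * x ^ 2 = -a * x ^ 2 + -a * x ^ 2 by ring, exp_add]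
    ring
  simp_rw [this]
  have i12 : Integrable (fun x => (1 - erf x ^ 2) ^ 2 -
    2 * (exp (-a * x ^ 2) * (1 - erf x ^ 2))) (volume.restrict (Ioi 0)) := i1.sub i2
  rw [integral_add i12 i3, integral_sub i1 i2, integral_const_mul,
    integral_exp_mul_one_sub_erf_sq ha, integral_one_sub_erf_sq_sq, integral_gaussian_Ioi,
    show (2 : ℝ) / (2 + 2) = 1 / 2 by norm_num, sqrt_mul pi_pos.le, sqrt_mul pi_pos.le,
    sqrt_div pi_pos.le, sqrt_div pi_pos.le]
  have hs : √π ≠ 0 := by positivity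
  have hsa : √a ≠ 0 := by positivity
  have hsa2 : √(2 * a) ≠ 0 := by positivity
  have hp : π = √π ^ 2 := (sq_sqrt pi_pos.le).symm
  generalize √π = p at *
  rw [hp]
  field_simp
  ring

theorem arctan_term_antitone {x : ℝ} (h0 : 0 ≤ x) (h1 : x ≤ 1) :
    Antitone fun n : ℕ => x ^ (2 * n + 1) / ((2 * n + 1 : ℕ) : ℝ) := by
  refine antitone_nat_of_succ_le fun n => ?_
  have : x ^ (2 * (n + 1) + 1) ≤ x ^ (2 * n + 1) := pow_le_pow_of_le_one h0 h1 (by omega)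
  gcongr
  omega

theorem tendsto_sum_arctan {x : ℝ} (h0 : 0 ≤ x) (h1 : x < 1) :
    Tendsto (fun n : ℕ => ∑ i ∈ Finset.range n,
      (-1) ^ i * (x ^ (2 * i + 1) / ((2 * i + 1 : ℕ) : ℝ))) atTop (𝓝 (arctan x)) := by
  simp_rw [← mul_div_assoc]
  exact (Real.hasSum_arctan (by rwa [norm_eq_abs, abs_of_nonneg h0])).tendsto_sum_nat

theorem le_arctan_approx : (0.55390947 : ℝ) ≤ arctan 0.6184972 := by
  refine le_trans ?_ ((arctan_term_antitone (by norm_num) (by norm_num)).alternating_series_le_tendsto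
    (tendsto_sum_arctan (by norm_num) (by norm_num)) 9)
  norm_num [Finset.sum_range_succ]

theorem arctan_le_approx : arctan 0.7071068 ≤ (0.615479722 : ℝ) := by
  refine ((arctan_term_antitone (by norm_num) (by norm_num)).tendsto_le_alternating_series
    (tendsto_sum_arctan (by norm_num) (by norm_num)) 12).trans ?_
  norm_num [Finset.sum_range_succ]

theorem lsqError_coefficient_mem_Icc :
    (1 + π) ^ ((2 : ℝ) / 3) * log 2 ^ 2 ∈ Icc (1.23907 : ℝ) 1.2390701 := by
  set c := (1 + π) ^ ((2 : ℝ) / 3) with hc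
  have hp : 0 < 1 + π := by positivity
  have hc0 : 0 < c := rpow_pos_of_pos hp _
  have hc3 : c ^ 3 = (1 + π) ^ 2 := by
    rw [hc, ← rpow_natCast, ← rpow_mul hp.le, ← rpow_natCast]
    norm_num
  have p1 := pi_gt_d20
  have p2 := pi_lt_d20
  have l1 := log_two_gt_d9
  have l2 := log_two_lt_d9
  have c1 : 2.578961869 ≤ c := by
    refine le_of_pow_le_pow_left₀ three_ne_zero hc0.le ?_
    rw [hc3]
    nlinarith
  have c2 : c ≤ 2.578961870 := by
    refine le_of_pow_le_pow_left₀ three_ne_zero (by norm_num) ?_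
    rw [hc3]
    nlinarith
  constructor
  · calc (1.23907 : ℝ) ≤ 2.578961869 * 0.6931471803 ^ 2 := by norm_num
      _ ≤ _ := by gcongr
  · calc _ ≤ (2.578961870 : ℝ) * 0.6931471808 ^ 2 := by gcongr
      _ ≤ _ := by norm_num

theorem lsqError_closed_form_lt {a : ℝ} (ha : a ∈ Icc (1.23907 : ℝ) 1.2390701) :
    (π / (2 * √(2 * a)) - 4 / √a * arctan (√(a / (2 + a))) +
        48 / (π * √2) * arctan (√(1 / 2)) - 8 / √2) / √π < 0.000026 := by
  obtain ⟨h1, h2⟩ := ha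
  have p1 := pi_gt_d20
  have p2 := pi_lt_d20
  have ha0 : 0 < a := by linarith
  have t1 : π / (2 * √(2 * a)) ≤ 3.1415926536 / (2 * 1.57421091) := by
    have : 1.57421091 ≤ √(2 * a) := le_sqrt_of_sq_le (by norm_num; linarith)
    gcongr
    linarith
  have t2 : 4 / 1.11313526 * 0.55390947 ≤ 4 / √a * arctan (√(a / (2 + a))) := by
    have hs : √a ≤ 1.11313526 := sqrt_le_iff.2 ⟨by norm_num, by norm_num; linarith⟩
    have hy : 0.6184972 ≤ √(a / (2 + a)) := by
      refine le_sqrt_of_sq_le ?_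
      rw [le_div_iff₀ (by linarith)]
      norm_num
      linarith
    have := le_arctan_approx.trans (arctan_strictMono.monotone hy)
    have hsa : 0 < √a := sqrt_pos.2 ha0
    gcongr
  have s1 : 1.414213562 ≤ √2 := le_sqrt_of_sq_le (by norm_num)
  have s2 : √2 ≤ 1.414213563 := sqrt_le_iff.2 ⟨by norm_num, by norm_num⟩
  have t3 : 48 / (π * √2) * arctan (√(1 / 2)) ≤
      48 / (3.14159265358 * 1.414213562) * 0.615479722 := by
    have hy : √(1 / 2) ≤ 0.7071068 := sqrt_le_iff.2 ⟨by norm_num, by norm_num⟩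
    have := (arctan_strictMono.monotone hy).trans arctan_le_approx
    have h0 : 0 ≤ arctan (√(1 / 2)) := arctan_nonneg.2 (sqrt_nonneg _)
    gcongr
    linarith
  have t4 : 8 / 1.414213563 ≤ 8 / √2 := by gcongr
  have s3 : 1.77245385 ≤ √π := le_sqrt_of_sq_le (by norm_num; linarith)
  rw [div_lt_iff₀ (by positivity)]
  norm_num at t1 t2 t3 t4 s3 ⊢
  linarith

/-- With `a = (1+π)^{2/3} (ln 2)²`, the least-squares error of the approximation
`erf(x)² ≈ 1 − exp(−a x²)` is less than `0.000026`. -/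
theorem lsqError_lt_bound :
    (∫ x in Set.Ioi (0:ℝ),
        (erf x ^ 2 -
          (1 - Real.exp (-((1 + π) ^ ((2:ℝ)/3) * Real.log 2 ^ 2) * x ^ 2))) ^ 2) <
      0.000026 := by
  have ha := lsqError_coefficient_mem_Icc
  rw [lsqError_eq (lt_of_lt_of_le (by norm_num) ha.1)]
  exact lsqError_closed_form_lt ha
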